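/- For every integer k ≥ 0 there exists a constant C > 0 depending only on k such that the following holds: for every C^∞ function u : ℝ² → ℝ with compact support vanishing on the line {y = 0}, and every C^∞ function w : ℝ² → ℝ with u(x,y) = y·w(x,y) for all (x,y), one has Σ_{s=0}^{k} ∫_{ℝ²} |∂ₓ^{k−s}∂_y^{s} w|² ≤ C · Σ_{s=0}^{k+1} ∫_{ℝ²} |∂ₓ^{k+1−s}∂_y^{s} u|², i.e. the H^k Sobolev seminorm of w is bounded by C times the H^{k+1} Sobolev seminorm of u. -/

import Mathlib

open MeasureTheory

/-- Mixed partial derivative of order `t` in the first variable and order `s` in the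
second variable of a function `f : ℝ × ℝ → ℝ`. -/
noncomputable def mixedPartial (t s : ℕ) (f : ℝ × ℝ → ℝ) : ℝ × ℝ → ℝ :=
  fun p => iteratedDeriv t (fun x => iteratedDeriv s (fun y => f (x, y)) p.2) p.1

/-- The derivative of a function on the plane in the fixed direction `v`. -/
noncomputable def dirDeriv (v : ℝ × ℝ) (f : ℝ × ℝ → ℝ) : ℝ × ℝ → ℝ :=
  fun p => fderiv ℝ f p v

theorem ContDiff.dirDeriv {f : ℝ × ℝ → ℝ} (hf : ContDiff ℝ (⊤ : ℕ∞) f) (v : ℝ × ℝ) :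
    ContDiff ℝ (⊤ : ℕ∞) (dirDeriv v f) :=
  (hf.fderiv_right (m := (⊤ : ℕ∞)) (by simp)).clm_apply contDiff_const

theorem ContDiff.iterate_dirDeriv {f : ℝ × ℝ → ℝ} (hf : ContDiff ℝ (⊤ : ℕ∞) f) (v : ℝ × ℝ)
    (n : ℕ) : ContDiff ℝ (⊤ : ℕ∞) ((_root_.dirDeriv v)^[n] f) := by
  induction n with
  | zero => exact hf
  | succ n ih => rw [Function.iterate_succ_apply']; exact ih.dirDeriv v

theorem HasCompactSupport.dirDeriv {f : ℝ × ℝ → ℝ} (hf : HasCompactSupport f) (v : ℝ × ℝ) :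
    HasCompactSupport (dirDeriv v f) :=
  (hf.fderiv ℝ).comp_left (g := fun L : ℝ × ℝ →L[ℝ] ℝ => L v) rfl

theorem HasCompactSupport.iterate_dirDeriv {f : ℝ × ℝ → ℝ} (hf : HasCompactSupport f)
    (v : ℝ × ℝ) (n : ℕ) : HasCompactSupport ((_root_.dirDeriv v)^[n] f) := by
  induction n with
  | zero => exact hf
  | succ n ih => rw [Function.iterate_succ_apply']; exact ih.dirDeriv v

theorem dirDeriv_comm {f : ℝ × ℝ → ℝ} (hf : ContDiff ℝ (⊤ : ℕ∞) f) (v v' : ℝ × ℝ) :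
    dirDeriv v (dirDeriv v' f) = dirDeriv v' (dirDeriv v f) := by
  have hd : Differentiable ℝ (fderiv ℝ f) :=
    (hf.fderiv_right (m := (⊤ : ℕ∞)) (by simp)).differentiable (by simp)
  have key : ∀ a b p, dirDeriv a (dirDeriv b f) p = fderiv ℝ (fderiv ℝ f) p a b := by
    intro a b p
    change fderiv ℝ (fun q => fderiv ℝ f q b) p a = _
    rw [fderiv_clm_apply (hd p) (differentiableAt_const b)]
    simp
  funext p
  rw [key, key]
  exact (hf.contDiffAt.isSymmSndFDerivAt (by
    rw [minSmoothness_of_isRCLikeNormedField]; exact WithTop.coe_le_coe.mpr le_top)).eq v v'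

theorem iterate_dirDeriv_comm {f : ℝ × ℝ → ℝ} (hf : ContDiff ℝ (⊤ : ℕ∞) f) (v v' : ℝ × ℝ)
    (n : ℕ) : (dirDeriv v)^[n] (dirDeriv v' f) = dirDeriv v' ((dirDeriv v)^[n] f) := by
  induction n with
  | zero => rfl
  | succ n ih =>
    rw [Function.iterate_succ_apply', Function.iterate_succ_apply', ih,
      dirDeriv_comm (hf.iterate_dirDeriv v n)]

theorem dirDeriv_snd_mul_add {a b : ℝ × ℝ → ℝ} (ha : ContDiff ℝ (⊤ : ℕ∞) a)
    (hb : ContDiff ℝ (⊤ : ℕ∞) b) (c : ℝ) (v : ℝ × ℝ) :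
    dirDeriv v (fun p => p.2 * a p + c * b p) =
      fun p => p.2 * dirDeriv v a p + v.2 * a p + c * dirDeriv v b p := by
  funext p
  have h1 := ((hasFDerivAt_snd (𝕜 := ℝ) (p := p)).mul
      (ha.differentiable (by simp) p).hasFDerivAt).add
    ((hb.differentiable (by simp) p).hasFDerivAt.const_mul c)
  change fderiv ℝ _ p v = _
  erw [h1.fderiv]
  simp [dirDeriv]
  ring

theorem iterate_dirDeriv_fst_snd_mul_add {a b : ℝ × ℝ → ℝ} (ha : ContDiff ℝ (⊤ : ℕ∞) a)
    (hb : ContDiff ℝ (⊤ : ℕ∞) b) (c : ℝ) (n : ℕ) :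
    (dirDeriv (1, 0))^[n] (fun p => p.2 * a p + c * b p) =
      fun p => p.2 * (dirDeriv (1, 0))^[n] a p + c * (dirDeriv (1, 0))^[n] b p := by
  induction n with
  | zero => rfl
  | succ n ih =>
    simp only [Function.iterate_succ_apply']
    rw [ih, dirDeriv_snd_mul_add (ha.iterate_dirDeriv _ n) (hb.iterate_dirDeriv _ n)]
    simp

theorem iterate_dirDeriv_snd_snd_mul {w : ℝ × ℝ → ℝ} (hw : ContDiff ℝ (⊤ : ℕ∞) w) (n : ℕ) :
    (dirDeriv (0, 1))^[n + 1] (fun p => p.2 * w p) =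
      fun p => p.2 * (dirDeriv (0, 1))^[n + 1] w p
        + ((n : ℝ) + 1) * (dirDeriv (0, 1))^[n] w p := by
  induction n with
  | zero =>
    have := dirDeriv_snd_mul_add hw hw 0 (0, 1)
    simpa using this
  | succ n ih =>
    rw [Function.iterate_succ_apply', ih,
      dirDeriv_snd_mul_add (hw.iterate_dirDeriv _ _) (hw.iterate_dirDeriv _ _)]
    funext p
    simp only [Function.iterate_succ_apply']
    push_cast
    ring

theorem hasDerivAt_slice_fst {f : ℝ × ℝ → ℝ} (hf : ContDiff ℝ (⊤ : ℕ∞) f) (x y : ℝ) :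
    HasDerivAt (fun x => f (x, y)) (dirDeriv (1, 0) f (x, y)) x :=
  (hf.differentiable (by simp) (x, y)).hasFDerivAt.comp_hasDerivAt x
    ((hasDerivAt_id x).prodMk (hasDerivAt_const x y))

theorem hasDerivAt_slice_snd {f : ℝ × ℝ → ℝ} (hf : ContDiff ℝ (⊤ : ℕ∞) f) (x y : ℝ) :
    HasDerivAt (fun y => f (x, y)) (dirDeriv (0, 1) f (x, y)) y :=
  (hf.differentiable (by simp) (x, y)).hasFDerivAt.comp_hasDerivAt y
    ((hasDerivAt_const y x).prodMk (hasDerivAt_id y))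

theorem iteratedDeriv_slice_fst {f : ℝ × ℝ → ℝ} (hf : ContDiff ℝ (⊤ : ℕ∞) f) (y : ℝ) (n : ℕ) :
    iteratedDeriv n (fun x => f (x, y)) = fun x => (dirDeriv (1, 0))^[n] f (x, y) := by
  induction n with
  | zero => simp
  | succ n ih =>
    rw [iteratedDeriv_succ, ih, Function.iterate_succ_apply']
    exact funext fun x => (hasDerivAt_slice_fst (hf.iterate_dirDeriv _ n) x y).deriv

theorem iteratedDeriv_slice_snd {f : ℝ × ℝ → ℝ} (hf : ContDiff ℝ (⊤ : ℕ∞) f) (x : ℝ) (n : ℕ) :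
    iteratedDeriv n (fun y => f (x, y)) = fun y => (dirDeriv (0, 1))^[n] f (x, y) := by
  induction n with
  | zero => simp
  | succ n ih =>
    rw [iteratedDeriv_succ, ih, Function.iterate_succ_apply']
    exact funext fun y => (hasDerivAt_slice_snd (hf.iterate_dirDeriv _ n) x y).deriv

theorem mixedPartial_eq_iterate_dirDeriv {f : ℝ × ℝ → ℝ} (hf : ContDiff ℝ (⊤ : ℕ∞) f)
    (t s : ℕ) : mixedPartial t s f = (dirDeriv (1, 0))^[t] ((dirDeriv (0, 1))^[s] f) := by
  funext p
  simp only [mixedPartial, iteratedDeriv_slice_snd hf,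
    iteratedDeriv_slice_fst (hf.iterate_dirDeriv (0, 1) s)]

/-- A smooth quotient of `u` by the second coordinate is compactly supported when `u` is. -/
theorem HasCompactSupport.of_eq_snd_mul {u w : ℝ × ℝ → ℝ} (hu : HasCompactSupport u)
    (hw : Continuous w) (h : ∀ x y : ℝ, u (x, y) = y * w (x, y)) : HasCompactSupport w := by
  refine HasCompactSupport.intro hu.isCompact fun p hp => ?_
  have hev : ∀ᶠ q in nhds p, u q = 0 := notMem_tsupport_iff_eventuallyEq.mp hp
  obtain ⟨x, y⟩ := p
  have hcont : Continuous fun z : ℝ => ((x, z) : ℝ × ℝ) := by fun_prop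
  have h1 : ∀ᶠ z in nhdsWithin y {y}ᶜ, u (x, z) = 0 :=
    (hcont.continuousAt.eventually hev).filter_mono nhdsWithin_le_nhds
  have h0 : ∀ᶠ z in nhdsWithin y {y}ᶜ, z ≠ 0 := by
    rcases eq_or_ne y 0 with rfl | hy
    · exact self_mem_nhdsWithin
    · exact Filter.Eventually.filter_mono nhdsWithin_le_nhds (isOpen_ne.mem_nhds hy)
  have hlim : Filter.Tendsto (fun z => w (x, z)) (nhdsWithin y {y}ᶜ) (nhds (w (x, y))) :=
    ((hw.comp hcont).tendsto y).mono_left nhdsWithin_le_nhds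
  refine tendsto_nhds_unique hlim (tendsto_const_nhds.congr' ?_)
  filter_upwards [h1, h0] with z hz hz0
  rw [h] at hz
  exact ((mul_eq_zero.mp hz).resolve_left hz0).symm

theorem integral_dirDeriv_snd_eq_zero {f : ℝ × ℝ → ℝ} (hf : ContDiff ℝ (⊤ : ℕ∞) f)
    (hc : HasCompactSupport f) : ∫ p, dirDeriv (0, 1) f p = 0 := by
  have hi : Integrable (dirDeriv (0, 1) f) :=
    (hf.dirDeriv _).continuous.integrable_of_hasCompactSupport (hc.dirDeriv _)
  rw [Measure.volume_eq_prod] at hi ⊢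
  rw [integral_prod _ hi]
  refine integral_eq_zero_of_ae (Filter.Eventually.of_forall fun x => ?_)
  have hs : ∀ {g : ℝ × ℝ → ℝ}, Continuous g → HasCompactSupport g →
      Integrable fun y => g (x, y) := fun {g} hg hgc =>
    (hg.comp (by fun_prop : Continuous fun y : ℝ => (x, y))).integrable_of_hasCompactSupport
      (hgc.comp_isClosedEmbedding (Isometry.isClosedEmbedding
        (Isometry.of_dist_eq fun a b => by simp [Prod.dist_eq])))
  exact integral_eq_zero_of_hasDerivAt_of_integrable (fun y => hasDerivAt_slice_snd hf x y)
    (hs (hf.dirDeriv _).continuous (hc.dirDeriv _)) (hs hf.continuous hc)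

/-- A Hardy-type inequality for the Euler operator `y ∂_y + c` with `c ≥ 1`. -/
theorem integral_sq_le_integral_snd_mul_dirDeriv_add {g : ℝ × ℝ → ℝ}
    (hg : ContDiff ℝ (⊤ : ℕ∞) g) (hc : HasCompactSupport g) {c : ℝ} (h1 : 1 ≤ c) :
    ∫ p, g p ^ 2 ≤ 4 * ∫ p : ℝ × ℝ, (p.2 * dirDeriv (0, 1) g p + c * g p) ^ 2 := by
  have hg2 : ContDiff ℝ (⊤ : ℕ∞) fun p => g p * g p := hg.mul hg
  have hF : ContDiff ℝ (⊤ : ℕ∞) fun p : ℝ × ℝ => p.2 * (g p * g p) := contDiff_snd.mul hg2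
  have hFc : HasCompactSupport fun p : ℝ × ℝ => p.2 * (g p * g p) :=
    (hc.mul_left (f := g)).mul_left (f := Prod.snd)
  have hdF : ∀ p, dirDeriv (0, 1) (fun p : ℝ × ℝ => p.2 * (g p * g p)) p =
      p.2 * (2 * g p * dirDeriv (0, 1) g p) + g p ^ 2 := by
    intro p
    refine (hasDerivAt_slice_snd hF p.1 p.2).unique ?_
    have hgd := hasDerivAt_slice_snd hg p.1 p.2
    refine ((hasDerivAt_id' p.2).fun_mul (hgd.fun_mul hgd)).congr_deriv ?_
    ring
  have hcd := (hg.dirDeriv (0, 1)).continuous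
  have hgc := hg.continuous
  have hsq : ∀ {f : ℝ × ℝ → ℝ}, Continuous f → HasCompactSupport f →
      Integrable fun p => f p ^ 2 := fun {f} hf hfc =>
    (hf.pow 2).integrable_of_hasCompactSupport <|
      HasCompactSupport.intro hfc.isCompact fun p hp => by
        simp [image_eq_zero_of_notMem_tsupport hp]
  have hi1 : Integrable fun p => g p ^ 2 := hsq hgc hc
  have hi2 : Integrable fun p : ℝ × ℝ => (p.2 * dirDeriv (0, 1) g p + c * g p) ^ 2 :=
    hsq (by fun_prop) (((hc.dirDeriv (0, 1)).mul_left (f := Prod.snd)).add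
      (hc.mul_left (f := fun _ => c)))
  have hi3 : Integrable (dirDeriv (0, 1) (fun p : ℝ × ℝ => p.2 * (g p * g p))) :=
    (hF.dirDeriv _).continuous.integrable_of_hasCompactSupport (hFc.dirDeriv _)
  have hle := integral_mono hi1 ((hi2.const_mul 4).sub (hi3.const_mul 2)) fun p => by
    simp only [hdF, Pi.sub_apply]
    nlinarith [sq_nonneg (2 * (p.2 * dirDeriv (0, 1) g p + c * g p) - g p),
      mul_nonneg (sub_nonneg.mpr h1) (sq_nonneg (g p))]
  rw [integral_sub' (hi2.const_mul 4) (hi3.const_mul 2), integral_const_mul, integral_const_mul,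
    integral_dirDeriv_snd_eq_zero hF hFc] at hle
  simpa using hle

/-- for every `k` there is `C > 0` (depending only on `k`) such that for all
smooth compactly supported `u` vanishing on `{y = 0}` and smooth `w` with `u = y·w`,
the `H^k` seminorm (squared) of `w` is bounded by `C` times the `H^{k+1}` seminorm
(squared) of `u`. -/
theorem stmt6 (k : ℕ) :
    ∃ C : ℝ, 0 < C ∧
      ∀ (u w : ℝ × ℝ → ℝ), ContDiff ℝ (⊤ : ℕ∞) u → HasCompactSupport u →
        (∀ x : ℝ, u (x, 0) = 0) → ContDiff ℝ (⊤ : ℕ∞) w →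
        (∀ x y : ℝ, u (x, y) = y * w (x, y)) →
        ∑ s ∈ Finset.range (k + 1), ∫ p : ℝ × ℝ, (mixedPartial (k - s) s w p) ^ 2 ≤
          C * ∑ s ∈ Finset.range (k + 2), ∫ p : ℝ × ℝ, (mixedPartial (k + 1 - s) s u p) ^ 2 := by
  refine ⟨4, by norm_num, fun u w hu hcu _ hw huw => ?_⟩
  have hcw := hcu.of_eq_snd_mul hw.continuous huw
  have hu_eq : u = fun p => p.2 * w p := funext fun p => huw p.1 p.2
  rw [Finset.sum_range_succ' _ (k + 1), mul_add, Finset.mul_sum]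
  refine le_add_of_le_of_nonneg (Finset.sum_le_sum fun s _ => ?_)
    (mul_nonneg (by norm_num) (integral_nonneg fun p => sq_nonneg _))
  have hws := hw.iterate_dirDeriv (0, 1) s
  rw [Nat.add_sub_add_right, mixedPartial_eq_iterate_dirDeriv hw,
    mixedPartial_eq_iterate_dirDeriv hu, hu_eq, iterate_dirDeriv_snd_snd_mul hw,
    iterate_dirDeriv_fst_snd_mul_add (hw.iterate_dirDeriv _ _) hws,
    Function.iterate_succ_apply', iterate_dirDeriv_comm hws]
  exact integral_sq_le_integral_snd_mul_dirDeriv_add (hws.iterate_dirDeriv _ _)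
    ((hcw.iterate_dirDeriv _ _).iterate_dirDeriv _ _) (by simp)
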